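/- arXiv:2309.17258 — 4 statements merged into one kernel-verified Lean document; each statement's English description precedes it below -/
import Mathlib

section
/- Let X be a second countable Baire topological space and let {A_γ : γ ∈ Γ} be a family of pairwise disjoint meager subsets of X whose union E is nonmeager. Then there exist a subset Δ ⊆ Γ and a nonempty open set O ⊆ X such that both ⋃_{γ∈Δ} A_γ and ⋃_{γ∈Γ\Δ} A_γ are everywhere nonmeager in O (i.e., their intersection with every nonempty open subset of O is nonmeager). -/
/-- `S` is everywhere nonmeager in `O`: its intersection with every nonempty open
subset of `O` is nonmeager. -/
def EverywhereNonmeagerIn {X : Type*} [TopologicalSpace X] (S O : Set X) : Prop :=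
  ∀ U : Set X, IsOpen U → U.Nonempty → U ⊆ O → ¬ IsMeagre (S ∩ U)

open Set TopologicalSpace

lemma IsMeagre.exists_seq_isClosed {X : Type*} [TopologicalSpace X] {s : Set X}
    (hs : IsMeagre s) :
    ∃ F : ℕ → Set X, (∀ n, IsClosed (F n)) ∧ (∀ n, IsNowhereDense (F n)) ∧ s ⊆ ⋃ n, F n := by
  obtain ⟨S, hS, hc, hsub⟩ := isMeagre_iff_countable_union_isNowhereDense.1 hs
  obtain ⟨g, hg⟩ := (hc.insert ∅).exists_eq_range (insert_nonempty _ _)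
  have hmem : ∀ n, IsNowhereDense (g n) := by
    intro n
    have h : g n ∈ insert ∅ S := hg ▸ mem_range_self n
    rcases h with h | h
    · rw [h]; simp [IsNowhereDense]
    · exact hS _ h
  refine ⟨fun n => closure (g n), fun n => isClosed_closure, fun n => ?_, fun x hx => ?_⟩
  · simpa [IsNowhereDense] using hmem n
  · obtain ⟨t, ht, hxt⟩ := hsub hx
    have h : t ∈ range g := hg ▸ mem_insert_of_mem _ ht
    obtain ⟨n, rfl⟩ := h
    exact mem_iUnion.2 ⟨n, subset_closure hxt⟩

lemma IsOpen.isNowhereDense_closure_diff {X : Type*} [TopologicalSpace X] {G : Set X}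
    (hG : IsOpen G) : IsNowhereDense (closure G \ G) := by
  rw [← hG.frontier_eq, isClosed_frontier.isNowhereDense_iff, ← frontier_compl]
  exact interior_frontier hG.isClosed_compl

/-- If no nonempty open set has both `S` and `T` everywhere nonmeager in it, then `S` and `T` are
separated by an open set modulo a meager set. -/
lemma exists_isOpen_separating_mod_meagre {X : Type*} [TopologicalSpace X]
    [SecondCountableTopology X] {S T : Set X}
    (h : ∀ O : Set X, IsOpen O → O.Nonempty → EverywhereNonmeagerIn S O →
      ¬ EverywhereNonmeagerIn T O) :
    ∃ W N : Set X, IsOpen W ∧ IsMeagre N ∧ (∀ x ∈ S, x ∉ N → x ∈ W) ∧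
      (∀ x ∈ T, x ∉ N → x ∉ W) := by
  have hb := isBasis_countableBasis X
  let W : Set X → Set X := fun S => ⋃₀ {U ∈ countableBasis X | IsMeagre (S ∩ U)}
  have hWo : ∀ S, IsOpen (W S) := fun S => isOpen_sUnion fun U hU => hb.isOpen hU.1
  have hWm : ∀ S, IsMeagre (S ∩ W S) := by
    intro S
    simp only [W, sUnion_eq_biUnion, inter_iUnion₂]
    exact isMeagre_biUnion ((countable_countableBasis X).mono (sep_subset _ _)) fun U hU => hU.2
  have hmeet : ∀ S O : Set X, IsOpen O → ¬ EverywhereNonmeagerIn S O → (O ∩ W S).Nonempty := by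
    intro S O hO hSO
    simp only [EverywhereNonmeagerIn, not_forall, not_not] at hSO
    obtain ⟨U, hU, ⟨x, hx⟩, hUO, hm⟩ := hSO
    obtain ⟨V, hV, hxV, hVU⟩ := hb.exists_subset_of_mem_open hx hU
    exact ⟨x, hUO hx, mem_sUnion.2 ⟨V, ⟨hV, hm.mono (inter_subset_inter_right S hVU)⟩, hxV⟩⟩
  have hdense : Dense (W S ∪ W T) := by
    rw [dense_iff_inter_open]
    intro O hO hne
    by_cases hS : EverywhereNonmeagerIn S O
    · exact (hmeet T O hO (h O hO hne hS)).mono (by gcongr; exact subset_union_right)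
    · exact (hmeet S O hO hS).mono (by gcongr; exact subset_union_left)
  have hres : IsMeagre (W S ∪ W T)ᶜ := by
    rw [IsMeagre, compl_compl]
    exact residual_of_dense_open ((hWo S).union (hWo T)) hdense
  refine ⟨W T, (W S ∪ W T)ᶜ ∪ (S ∩ W S ∪ T ∩ W T), hWo T,
    hres.union ((hWm S).union (hWm T)), ?_, ?_⟩
  · intro x hx hN
    simp only [mem_union, mem_compl_iff, mem_inter_iff] at hN
    tauto
  · intro x hx hN
    simp only [mem_union, mem_compl_iff, mem_inter_iff] at hN
    tauto

lemma exists_everywhereNonmeagerIn_of_isMeagre_initial {X : Type*} [TopologicalSpace X]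
    [SecondCountableTopology X] {Γ : Type*} [LinearOrder Γ] (A : Γ → Set X)
    (hinit : ∀ γ, IsMeagre (⋃ β ≤ γ, A β)) (hE : ¬ IsMeagre (⋃ γ, A γ)) :
    ∃ (Δ : Set Γ) (O : Set X), IsOpen O ∧ O.Nonempty ∧
      EverywhereNonmeagerIn (⋃ γ ∈ Δ, A γ) O ∧
      EverywhereNonmeagerIn (⋃ γ ∈ Δᶜ, A γ) O := by
  by_contra! hcon
  have hb := isBasis_countableBasis X
  have : Countable (countableBasis X) := (countable_countableBasis X).to_subtype
  have hΓ : Nonempty Γ := by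
    obtain ⟨x, hx⟩ := nonempty_of_not_isMeagre hE
    exact ⟨(mem_iUnion.1 hx).choose⟩
  have hf : ∀ x, x ∈ ⋃ γ, A γ → ∃ γ, x ∈ A γ := fun x hx => mem_iUnion.1 hx
  choose! f hf using hf
  choose F hFc hFn hF using fun γ => (hinit γ).exists_seq_isClosed
  choose W N hWo hN hWS hWT using fun (n : ℕ) (m : countableBasis X) =>
    exists_isOpen_separating_mod_meagre (hcon {γ | Disjoint (m : Set X) (F γ n)})
  set C : Set X := (⋃ γ, A γ) \ ⋃ n, ⋃ m, N n m with hCdef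
  have hC : ¬ IsMeagre C := by
    intro h
    refine hE ((h.union (isMeagre_iUnion fun n => isMeagre_iUnion (hN n))).mono ?_)
    rw [hCdef, sdiff_union_self]
    exact subset_union_left
  have hfC : ∀ x ∈ C, x ∈ A (f x) := fun x hx => hf x hx.1
  have hiff : ∀ x ∈ C, ∀ n m, x ∈ W n m ↔ Disjoint (m : Set X) (F (f x) n) := by
    intro x hx n m
    have hxN : x ∉ N n m := fun h => hx.2 (mem_iUnion₂.2 ⟨n, m, h⟩)
    refine ⟨fun h => ?_, fun h => hWS n m x (mem_iUnion₂.2 ⟨f x, h, hfC x hx⟩) hxN⟩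
    by_contra hd
    exact hWT n m x (mem_iUnion₂.2 ⟨f x, hd, hfC x hx⟩) hxN h
  let G : ℕ → X → Set X := fun n y => ⋃ m : {m : countableBasis X // y ∈ (m : Set X)}, W n m
  have hGo : ∀ n y, IsOpen (G n y) := fun n y => isOpen_iUnion fun m => hWo n m
  have hG : ∀ x ∈ C, ∀ n y, x ∈ G n y ↔ y ∉ F (f x) n := by
    intro x hx n y
    simp only [G, mem_iUnion]
    constructor
    · rintro ⟨⟨m, hym⟩, hxm⟩
      exact disjoint_left.1 ((hiff x hx n m).1 hxm) hym
    · intro hy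
      obtain ⟨V, hV, hyV, hVF⟩ := hb.exists_subset_of_mem_open (show y ∈ (F (f x) n)ᶜ from hy)
        (hFc _ n).isOpen_compl
      exact ⟨⟨⟨V, hV⟩, hyV⟩, (hiff x hx n _).2 (subset_compl_iff_disjoint_right.1 hVF)⟩
  have hp : ∀ m : countableBasis X, (C ∩ m).Nonempty → ∃ x, x ∈ C ∩ m := fun m h => h
  have hX : Nonempty X := ⟨(nonempty_of_not_isMeagre hC).some⟩
  choose! p hp using hp
  have hbad : IsMeagre (⋃ m : countableBasis X, ⋃ n, F (f (p m)) n) :=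
    isMeagre_iUnion fun m => isMeagre_iUnion fun n => (hFn _ n).isMeagre
  obtain ⟨y, hyC, hy⟩ : ∃ y ∈ C, y ∉ ⋃ m : countableBasis X, ⋃ n, F (f (p m)) n := by
    by_contra! h
    exact hC (hbad.mono h)
  have hCG : ∀ n, C ⊆ closure (G n y) := by
    intro n x hx
    rw [hb.mem_closure_iff]
    intro V hV hxV
    have hpV := hp ⟨V, hV⟩ ⟨x, hx, hxV⟩
    exact ⟨_, hpV.2, (hG _ hpV.1 n y).2 fun h => hy (mem_iUnion₂.2 ⟨_, n, h⟩)⟩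
  refine hC (((hinit (f y)).union (isMeagre_iUnion fun n =>
    (hGo n y).isNowhereDense_closure_diff.isMeagre)).mono fun x hx => ?_)
  rcases le_total (f x) (f y) with h | h
  · exact Or.inl (mem_iUnion₂.2 ⟨f x, h, hfC x hx⟩)
  · obtain ⟨n, hn⟩ := mem_iUnion.1 (hF (f x) (mem_iUnion₂.2 ⟨f y, h, hfC y hyC⟩))
    exact Or.inr (mem_iUnion.2 ⟨n, hCG n hx, fun hxG => (hG x hx n y).1 hxG hn⟩)

lemma EverywhereNonmeagerIn.mono {X : Type*} [TopologicalSpace X] {S T O : Set X}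
    (h : EverywhereNonmeagerIn S O) (hST : S ⊆ T) : EverywhereNonmeagerIn T O :=
  fun U hU hne hUO hm => h U hU hne hUO (hm.mono (inter_subset_inter_left U hST))

theorem stmt1 {X : Type*} [TopologicalSpace X] [SecondCountableTopology X]
    [BaireSpace X] {Γ : Type*} (A : Γ → Set X)
    (hdisj : Pairwise (Function.onFun Disjoint A))
    (hmeager : ∀ γ, IsMeagre (A γ))
    (hE : ¬ IsMeagre (⋃ γ, A γ)) :
    ∃ (Δ : Set Γ) (O : Set X), IsOpen O ∧ O.Nonempty ∧
      EverywhereNonmeagerIn (⋃ γ ∈ Δ, A γ) O ∧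
      EverywhereNonmeagerIn (⋃ γ ∈ Δᶜ, A γ) O := by
  obtain ⟨_, hwf⟩ := exists_wellFoundedLT Γ
  by_cases hinit : ∀ γ, IsMeagre (⋃ β ≤ γ, A β)
  · exact exists_everywhereNonmeagerIn_of_isMeagre_initial A hinit hE
  push Not at hinit
  obtain ⟨γ, hγ, hmin⟩ := wellFounded_lt.has_min {γ | ¬ IsMeagre (⋃ β ≤ γ, A β)} hinit
  obtain ⟨Δ, O, hO, hne, h₁, h₂⟩ := exists_everywhereNonmeagerIn_of_isMeagre_initial
    (fun β : Iio γ => A β)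
    (fun β => (not_not.1 fun h => hmin β h β.2 : IsMeagre (⋃ α ≤ (β : Γ), A α)).mono
      (iUnion₂_subset fun α hα => subset_iUnion₂_of_subset (α : Γ) hα subset_rfl))
    (fun h => hγ ((h.union (hmeager γ)).mono (iUnion₂_subset fun β hβ => by
      rcases hβ.lt_or_eq with hlt | rfl
      · exact subset_union_of_subset_left
          (subset_iUnion (fun β : Iio γ => A β) ⟨β, hlt⟩) _
      · exact subset_union_right)))
  refine ⟨Subtype.val '' Δ, O, hO, hne, h₁.mono ?_, h₂.mono ?_⟩
  · exact iUnion₂_subset fun β hβ =>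
      subset_iUnion₂_of_subset (β : Γ) (mem_image_of_mem _ hβ) subset_rfl
  · refine iUnion₂_subset fun β hβ => subset_iUnion₂_of_subset (β : Γ) ?_ subset_rfl
    rintro ⟨α, hα, h⟩
    exact hβ (Subtype.ext h ▸ hα)
end

section
/- Let X be a second countable Baire topological space and let {A_γ : γ ∈ Γ} be a family of pairwise disjoint meager subsets of X whose union is nonmeager. Then there exists Δ ⊆ Γ such that ⋃_{γ∈Δ} A_γ and ⋃_{γ∈Γ\Δ} A_γ cannot be separated by a set with the Baire property: there is no set B with the Baire property such that ⋃_{γ∈Δ} A_γ ⊆ B and B ∩ ⋃_{γ∈Γ\Δ} A_γ = ∅. In particular, ⋃_{γ∈Δ} A_γ does not have the Baire property. -/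
/-- A set has the Baire property if it differs from an open set by a meager set. -/
def HasBaireProp {X : Type*} [TopologicalSpace X] (S : Set X) : Prop :=
  ∃ U : Set X, IsOpen U ∧ IsMeagre (symmDiff S U)

open Set TopologicalSpace

/-- A meager set is avoided by the intersection of a sequence of dense open sets. -/
lemma IsMeagre.exists_seq_isOpen_dense {X : Type*} [TopologicalSpace X] {s : Set X}
    (hs : IsMeagre s) :
    ∃ D : ℕ → Set X, (∀ n, IsOpen (D n)) ∧ (∀ n, Dense (D n)) ∧ ⋂ n, D n ⊆ sᶜ := by
  obtain ⟨S, hSo, hSd, hSc, hSs⟩ := mem_residual_iff.1 hs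
  obtain ⟨D, hD⟩ := (hSc.insert univ).exists_eq_range (insert_nonempty _ _)
  have hmem : ∀ n, D n ∈ insert univ S := fun n => hD ▸ mem_range_self n
  refine ⟨D, fun n => ?_, fun n => ?_, fun x hx => hSs fun t ht => ?_⟩
  · rcases hmem n with h | h
    · exact h ▸ isOpen_univ
    · exact hSo _ h
  · rcases hmem n with h | h
    · exact h ▸ dense_univ
    · exact hSd _ h
  · obtain ⟨n, rfl⟩ : t ∈ range D := hD ▸ mem_insert_of_mem _ ht
    exact mem_iInter.1 hx n

/-- In a family of meager sets with nonmeager union indexed by a well-order, the indices whose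
initial segment has meager union still have nonmeager union. -/
lemma not_isMeagre_iUnion_of_isMeagre_biUnion_Iic {X : Type*} [TopologicalSpace X] {Γ : Type*}
    [LinearOrder Γ] [WellFoundedLT Γ] (A : Γ → Set X) (hmeager : ∀ γ, IsMeagre (A γ))
    (hE : ¬ IsMeagre (⋃ γ, A γ)) :
    ¬ IsMeagre (⋃ γ : {γ // IsMeagre (⋃ β ∈ Iic γ, A β)}, A γ) := by
  intro hm
  by_cases h : ∀ γ, IsMeagre (⋃ β ∈ Iic γ, A β)
  · exact hE (hm.mono (iUnion_subset fun γ => subset_iUnion_of_subset ⟨γ, h γ⟩ Subset.rfl))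
  push Not at h
  obtain ⟨γ, hγ, hmin⟩ := wellFounded_lt.has_min {γ | ¬ IsMeagre (⋃ β ∈ Iic γ, A β)} h
  refine hγ ((hm.union (hmeager γ)).mono (iUnion₂_subset fun β hβ => ?_))
  rcases (mem_Iic.1 hβ).eq_or_lt with rfl | hβ
  · exact subset_union_right
  · have hβm : IsMeagre (⋃ α ∈ Iic β, A α) := not_not.1 fun hn => hmin β hn hβ
    exact fun x hx => Or.inl (mem_iUnion.2 ⟨⟨β, hβm⟩, hx⟩)

/-- If the unions over initial segments of a linearly ordered family are meager but the whole union
is not, then some subfamily cannot be separated from the complementary subfamily by a set with the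
Baire property. -/
lemma exists_not_hasBaireProp_separated {X : Type*} [TopologicalSpace X]
    [SecondCountableTopology X] {Γ : Type*} [LinearOrder Γ] (A : Γ → Set X)
    (hmeager : ∀ γ, IsMeagre (⋃ β ∈ Iic γ, A β)) (hE : ¬ IsMeagre (⋃ γ, A γ)) :
    ∃ Δ : Set Γ,
      ¬ ∃ B : Set X, HasBaireProp B ∧ (⋃ γ ∈ Δ, A γ) ⊆ B ∧ B ∩ (⋃ γ ∈ Δᶜ, A γ) = ∅ := by
  by_contra! hsep
  choose D hDo hDd hDA using fun γ => (hmeager γ).exists_seq_isOpen_dense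
  set E := ⋃ γ, A γ
  have hbasis := isBasis_countableBasis X
  -- Up to a meager set, membership in an open set `V n U` decides whether `U ⊆ D γ n`.
  have hcode : ∀ (n : ℕ) (U : countableBasis X), ∃ V N : Set X, IsOpen V ∧ IsMeagre N ∧
      ∀ γ, ∀ x ∈ A γ, x ∉ N → (x ∈ V ↔ (U : Set X) ⊆ D γ n) := by
    intro n U
    obtain ⟨B, ⟨V, hV, hBV⟩, hB₁, hB₂⟩ := hsep {γ | (U : Set X) ⊆ D γ n}
    refine ⟨V, symmDiff B V, hV, hBV, fun γ x hx hxN => ?_⟩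
    have hBV : x ∈ B ↔ x ∈ V := by
      rw [mem_symmDiff] at hxN
      tauto
    refine hBV.symm.trans ⟨fun hxB => by_contra fun hγ => ?_, fun hγ => hB₁ (mem_biUnion hγ hx)⟩
    exact (hB₂ ▸ (⟨hxB, mem_biUnion hγ hx⟩ : x ∈ B ∩ _) : x ∈ (∅ : Set X))
  choose V N hV hN hVN using hcode
  set M := ⋃ n, ⋃ U, N n U
  have hM : IsMeagre M := isMeagre_iUnion fun n => isMeagre_iUnion fun U => hN n U
  -- The horizontal sections of an open set whose vertical section at `x ∈ A γ \ M` is `D γ n`.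
  let T : ℕ → X → Set X := fun n y => ⋃ (U : countableBasis X) (_ : y ∈ (U : Set X)), V n U
  have hTo : ∀ n y, IsOpen (T n y) := fun n y => isOpen_iUnion fun U => isOpen_iUnion fun _ => hV n U
  have hT : ∀ n y γ, ∀ x ∈ A γ, x ∉ M → (x ∈ T n y ↔ y ∈ D γ n) := by
    intro n y γ x hx hxM
    have hxN : ∀ U, x ∉ N n U := fun U h => hxM (mem_iUnion₂.2 ⟨n, U, h⟩)
    simp only [T, mem_iUnion, exists_prop]
    constructor
    · rintro ⟨U, hy, hxV⟩
      exact (hVN n U γ x hx (hxN U)).1 hxV hy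
    · intro hy
      obtain ⟨U, hU, hyU, hUD⟩ := hbasis.exists_subset_of_mem_open hy (hDo γ n)
      exact ⟨⟨U, hU⟩, hyU, (hVN n ⟨U, hU⟩ γ x hx (hxN _)).2 hUD⟩
  let good : Set (countableBasis X) := {W | ¬ IsMeagre (E ∩ W)}
  let Z : ℕ → countableBasis X → Set X := fun n W => {y | (T n y ∩ W).Nonempty}
  have hZ : ∀ n, ∀ W ∈ good, IsMeagre (Z n W)ᶜ := by
    intro n W hW
    obtain ⟨x, ⟨hxE, hxW⟩, hxM⟩ : ((E ∩ W) \ M).Nonempty := by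
      rw [nonempty_iff_ne_empty, Ne, sdiff_eq_empty]
      exact fun h => hW (hM.mono h)
    obtain ⟨γ, hx⟩ := mem_iUnion.1 hxE
    rw [IsMeagre, compl_compl]
    exact Filter.mem_of_superset (residual_of_dense_open (hDo γ n) (hDd γ n)) fun y hy =>
      ⟨x, (hT n y γ x hx hxM).2 hy, hxW⟩
  have hZ' : IsMeagre (⋃ (n) (W ∈ good), (Z n W)ᶜ) :=
    isMeagre_iUnion fun n => isMeagre_biUnion (to_countable good) (hZ n)
  obtain ⟨y, ⟨hyE, hyM⟩, hy⟩ : ((E \ M) \ ⋃ (n) (W ∈ good), (Z n W)ᶜ).Nonempty := by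
    rw [sdiff_sdiff, nonempty_iff_ne_empty, Ne, sdiff_eq_empty]
    exact fun h => hE ((hM.union hZ').mono h)
  obtain ⟨β, hyβ⟩ := mem_iUnion.1 hyE
  have hmeet : ∀ n, ∀ W ∈ good, (T n y ∩ W).Nonempty := by
    intro n W hW
    by_contra h
    exact hy (mem_iUnion.2 ⟨n, mem_biUnion hW h⟩)
  set G : Set X := ⋃ W ∈ goodᶜ, E ∩ W
  have hG : IsMeagre G := isMeagre_biUnion (to_countable _) fun W hW => not_not.1 hW
  have hS : ∀ n, IsNowhereDense ((E \ G) \ T n y) := by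
    intro n
    rw [IsNowhereDense, eq_empty_iff_forall_notMem]
    intro z hz
    obtain ⟨W, hW, hzW, hWS⟩ := hbasis.exists_subset_of_mem_open hz isOpen_interior
    obtain ⟨x, hxW, ⟨hxE, hxG⟩, -⟩ :=
      mem_closure_iff.1 (interior_subset hz) W (hbasis.isOpen hW) hzW
    have hgood : (⟨W, hW⟩ : countableBasis X) ∈ good :=
      by_contra fun h => hxG (mem_biUnion h ⟨hxE, hxW⟩)
    obtain ⟨w, hwT, hwW⟩ := hmeet n _ hgood
    obtain ⟨v, hvT, -, hvT'⟩ :=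
      mem_closure_iff.1 (interior_subset (hWS hwW)) (T n y) (hTo n y) hwT
    exact hvT' hvT
  refine hE (((hG.union (isMeagre_iUnion fun n => (hS n).isMeagre)).union
    (hM.union (hmeager β))).mono fun x hxE => ?_)
  by_contra hx
  simp only [mem_union, not_or, mem_iUnion, not_exists] at hx
  obtain ⟨⟨hxG, hxS⟩, hxM, hxβ⟩ := hx
  obtain ⟨α, hxα⟩ := mem_iUnion.1 hxE
  have hβα : β ≤ α := not_lt.1 fun h => hxβ α h.le hxα
  refine hDA α (mem_iInter.2 fun n => (hT n y α x hxα hxM).1 ?_) (mem_biUnion hβα hyβ)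
  exact by_contra fun h => hxS n ⟨⟨hxE, hxG⟩, h⟩

theorem stmt2 {X : Type*} [TopologicalSpace X] [SecondCountableTopology X]
    [BaireSpace X] {Γ : Type*} (A : Γ → Set X)
    (hdisj : Pairwise (Function.onFun Disjoint A))
    (hmeager : ∀ γ, IsMeagre (A γ))
    (hE : ¬ IsMeagre (⋃ γ, A γ)) :
    ∃ Δ : Set Γ,
      (¬ ∃ B : Set X, HasBaireProp B ∧ (⋃ γ ∈ Δ, A γ) ⊆ B ∧ B ∩ (⋃ γ ∈ Δᶜ, A γ) = ∅) ∧
      ¬ HasBaireProp (⋃ γ ∈ Δ, A γ) := by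
  obtain ⟨_, _⟩ := exists_wellFoundedLT Γ
  obtain ⟨Δ, hΔ⟩ := exists_not_hasBaireProp_separated
    (fun γ : {γ // IsMeagre (⋃ β ∈ Iic γ, A β)} => A γ)
    (fun γ => γ.2.mono (iUnion₂_subset fun β hβ => subset_biUnion_of_mem (u := A) (mem_Iic.2 hβ)))
    (not_isMeagre_iUnion_of_isMeagre_biUnion_Iic A hmeager hE)
  have hsep : ¬ ∃ B : Set X, HasBaireProp B ∧ (⋃ γ ∈ Subtype.val '' Δ, A γ) ⊆ B ∧
      B ∩ (⋃ γ ∈ (Subtype.val '' Δ)ᶜ, A γ) = ∅ := by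
    rintro ⟨B, hB, hB₁, hB₂⟩
    refine hΔ ⟨B, hB, (iUnion₂_subset fun γ hγ => ?_).trans hB₁,
      subset_empty_iff.1 ((inter_subset_inter_right B (iUnion₂_subset fun γ hγ => ?_)).trans hB₂.le)⟩
    · exact subset_biUnion_of_mem (u := A) (mem_image_of_mem _ hγ)
    · exact subset_biUnion_of_mem (u := A)
        (fun h => hγ ((Subtype.val_injective.mem_set_image).1 h))
  refine ⟨Subtype.val '' Δ, hsep, fun h => hsep ⟨_, h, Subset.rfl, ?_⟩⟩
  rw [← disjoint_iff_inter_eq_empty]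
  simp only [disjoint_iUnion_left, disjoint_iUnion_right]
  exact fun γ hγ δ hδ => hdisj fun h => hγ (h ▸ hδ)
end

section
/- Let μ be a Borel measure on a second countable topological space X and let {A_γ : γ ∈ Γ} be a family of pairwise disjoint μ-null sets whose union E has positive outer measure. Then there exists Δ ⊆ Γ such that ⋃_{γ∈Δ} A_γ and ⋃_{γ∈Γ\Δ} A_γ cannot be separated by μ-measurable sets: there is no μ-measurable set B containing ⋃_{γ∈Δ} A_γ and disjoint from ⋃_{γ∈Γ\Δ} A_γ. In particular, ⋃_{γ∈Δ} A_γ is not μ-measurable. -/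
open MeasureTheory

/-- In a countably generated measurable space with a finite measure, there is a sequence of
measurable sets whose unions cover every null set with arbitrarily small measure. -/
lemma exists_seq_forall_null_cover {X : Type*} [MeasurableSpace X]
    [MeasurableSpace.CountablyGenerated X] (μ : Measure X) [IsFiniteMeasure μ] :
    ∃ O : ℕ → Set X, (∀ k, MeasurableSet (O k)) ∧
      ∀ N, μ N = 0 → ∀ ε : ENNReal, 0 < ε →
        ∃ K : Set ℕ, N ⊆ ⋃ k ∈ K, O k ∧ μ (⋃ k ∈ K, O k) < ε := by
  set f := MeasurableSpace.mapNatBool X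
  have hf : Measurable f := MeasurableSpace.measurable_mapNatBool X
  have hcomap : ∀ s : Set X, MeasurableSet s →
      MeasurableSet[MeasurableSpace.comap f inferInstance] s := by
    suffices h : (inferInstance : MeasurableSpace X) ≤ MeasurableSpace.comap f inferInstance from h
    rw [← MeasurableSpace.generateFrom_natGeneratingSequence X]
    refine MeasurableSpace.generateFrom_le ?_
    rintro _ ⟨n, rfl⟩
    refine ⟨{y | y n = true}, measurableSet_eq_fun (measurable_pi_apply n) measurable_const, ?_⟩
    ext x
    simp [f, MeasurableSpace.mapNatBool]
  have hbasis := TopologicalSpace.isBasis_countableBasis (ℕ → Bool)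
  obtain ⟨b, hb⟩ := (TopologicalSpace.countable_countableBasis (ℕ → Bool)).exists_eq_range
    (Set.nonempty_iff_ne_empty.2 fun h => by
      simpa [h, Set.empty_ne_univ] using hbasis.sUnion_eq)
  refine ⟨fun k => f ⁻¹' b k, fun k => hf (hbasis.isOpen (hb ▸ ⟨k, rfl⟩)).measurableSet, ?_⟩
  intro N hN ε hε
  obtain ⟨M, hM, hMN⟩ := hcomap _ (measurableSet_toMeasurable μ N)
  have hM0 : μ.map f M < ε := by
    rwa [Measure.map_apply hf hM, hMN, measure_toMeasurable, hN]
  obtain ⟨U, hMU, hU, hUε⟩ := M.exists_isOpen_lt_of_lt ε hM0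
  have hUK : U = ⋃ k ∈ {k | b k ⊆ U}, b k := by
    refine Set.Subset.antisymm (fun y hy => ?_) (Set.iUnion₂_subset fun k hk => hk)
    obtain ⟨v, hv, hyv, hvU⟩ := hbasis.exists_subset_of_mem_open hy hU
    obtain ⟨k, rfl⟩ := hb ▸ hv
    exact Set.mem_biUnion (show b k ⊆ U from hvU) hyv
  have hpre : ⋃ k ∈ {k | b k ⊆ U}, f ⁻¹' b k = f ⁻¹' U := by
    conv_rhs => rw [hUK]
    simp only [Set.preimage_iUnion]
  refine ⟨{k | b k ⊆ U}, ?_, ?_⟩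
  · rw [hpre]
    exact (subset_toMeasurable μ N).trans (hMN ▸ Set.preimage_mono hMU)
  · rwa [hpre, ← Measure.map_apply hf hU.measurableSet]

/-- The outer measure on the index set of a family `A` that sends a set of indices to the
outer measure of the union of the corresponding members. -/
noncomputable def unionOuterMeasure {X Γ : Type*} [MeasurableSpace X] (μ : Measure X)
    (A : Γ → Set X) : OuterMeasure Γ where
  measureOf Δ := μ (⋃ γ ∈ Δ, A γ)
  empty := by simp
  mono h := measure_mono (Set.biUnion_subset_biUnion_left h)
  iUnion_nat s _ := by
    rw [Set.biUnion_iUnion]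
    exact measure_iUnion_le _

lemma top_le_caratheodory_unionOuterMeasure {X Γ : Type*} [MeasurableSpace X] {μ : Measure X}
    {A : Γ → Set X}
    (hsep : ∀ Δ : Set Γ, ∃ B : Set X, NullMeasurableSet B μ ∧ (⋃ γ ∈ Δ, A γ) ⊆ B ∧
      B ∩ (⋃ γ ∈ Δᶜ, A γ) = ∅) :
    (⊤ : MeasurableSpace Γ) ≤ (unionOuterMeasure μ A).caratheodory := by
  intro Δ _
  rw [OuterMeasure.isCaratheodory_iff]
  intro T
  obtain ⟨B, hB, hsub, hdisj⟩ := hsep Δ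
  change μ (⋃ γ ∈ T, A γ) = μ (⋃ γ ∈ T ∩ Δ, A γ) + μ (⋃ γ ∈ T \ Δ, A γ)
  rw [← measure_inter_add_sdiff₀ (⋃ γ ∈ T, A γ) hB]
  have hnot : ∀ γ ∉ Δ, ∀ x ∈ A γ, x ∉ B := fun γ hγ x hx hxB =>
    (Set.eq_empty_iff_forall_notMem.1 hdisj x) ⟨hxB, Set.mem_biUnion hγ hx⟩
  have hmem : ∀ γ ∈ Δ, ∀ x ∈ A γ, x ∈ B := fun γ hγ x hx => hsub (Set.mem_biUnion hγ hx)
  congr 2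
  all_goals
    ext x
    simp only [Set.mem_inter_iff, Set.mem_sdiff, Set.mem_iUnion, exists_prop]
    grind

/-- If every subfamily of a family of null sets can be separated from its complement, then the
union of the family is null. -/
lemma measure_iUnion_eq_zero_of_forall_separated {X Γ : Type*} [MeasurableSpace X]
    [MeasurableSpace.CountablyGenerated X] (μ : Measure X) [IsFiniteMeasure μ] (A : Γ → Set X)
    (hnull : ∀ γ, μ (A γ) = 0)
    (hsep : ∀ Δ : Set Γ, ∃ B : Set X, NullMeasurableSet B μ ∧ (⋃ γ ∈ Δ, A γ) ⊆ B ∧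
      B ∩ (⋃ γ ∈ Δᶜ, A γ) = ∅) :
    μ (⋃ γ, A γ) = 0 := by
  by_contra hE
  let _ : MeasurableSpace Γ := ⊤
  obtain ⟨_, _⟩ := exists_wellFoundedLT Γ
  let ν : Measure Γ :=
    (unionOuterMeasure μ A).toMeasure (top_le_caratheodory_unionOuterMeasure hsep)
  have hν : ∀ Δ, ν Δ = μ (⋃ γ ∈ Δ, A γ) := fun Δ =>
    toMeasure_apply _ _ (MeasurableSpace.measurableSet_top)
  have : IsFiniteMeasure ν := ⟨by rw [hν]; exact measure_lt_top _ _⟩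
  have hsingle : ∀ γ, ν {γ} = 0 := fun γ => by simp [hν, hnull]
  -- `S` is an initial segment of positive measure all of whose proper initial segments are null.
  set S : Set Γ := {ξ | ν (Set.Iio ξ) = 0}
  have hS : ν S ≠ 0 := by
    intro h0
    by_cases hne : Sᶜ.Nonempty
    · obtain ⟨ξ, hξ, hmin⟩ := WellFounded.has_min (wellFounded_lt (α := Γ)) _ hne
      refine hξ (measure_mono_null (fun η hη => ?_) h0)
      by_contra hηS
      exact hmin η hηS hη
    · rw [Set.not_nonempty_iff_eq_empty, Set.compl_empty_iff] at hne
      rw [hne, hν, Set.biUnion_univ] at h0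
      exact hE h0
  obtain ⟨O, hO, hcover⟩ := exists_seq_forall_null_cover μ
  have hK : ∀ (ξ : Γ) (n : ℕ), ∃ K : Set ℕ, ξ ∈ S →
      (⋃ γ ∈ Set.Iio ξ, A γ) ⊆ ⋃ k ∈ K, O k ∧ μ (⋃ k ∈ K, O k) < (n + 1 : ENNReal)⁻¹ := by
    intro ξ n
    by_cases hξ : ξ ∈ S
    · obtain ⟨K, hK⟩ := hcover (⋃ γ ∈ Set.Iio ξ, A γ) (by rw [← hν]; exact hξ)
        ((n + 1 : ENNReal)⁻¹) (by simp)
      exact ⟨K, fun _ => hK⟩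
    · exact ⟨∅, fun h => absurd h hξ⟩
  choose K hK using hK
  set V : Set (Γ × X) := ⋂ n, ⋃ k, {ξ | ξ ∈ S ∧ k ∈ K ξ n} ×ˢ O k
  have hV : MeasurableSet V := MeasurableSet.iInter fun n => MeasurableSet.iUnion fun k =>
    MeasurableSpace.measurableSet_top.prod (hO k)
  have hVmem : ∀ ξ x, (ξ, x) ∈ V ↔ ξ ∈ S ∧ ∀ n, x ∈ ⋃ k ∈ K ξ n, O k := by
    intro ξ x
    simp only [V, Set.mem_iInter, Set.mem_iUnion, Set.mem_prod, Set.mem_ofPred_eq, exists_prop]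
    exact ⟨fun h => ⟨(h 0).choose_spec.1.1, fun n => (h n).imp fun k hk => ⟨hk.1.2, hk.2⟩⟩,
      fun h n => (h.2 n).imp fun k hk => ⟨⟨h.1, hk.1⟩, hk.2⟩⟩
  have hprod : ν.prod μ V = 0 := by
    rw [Measure.measure_prod_null hV]
    refine Filter.Eventually.of_forall fun ξ => ?_
    by_cases hξ : ξ ∈ S
    · refine nonpos_iff_eq_zero.1 (le_of_forall_gt fun ε hε => ?_)
      obtain ⟨n, hn⟩ := ENNReal.exists_inv_nat_lt hε.ne'
      have hle : μ (Prod.mk ξ ⁻¹' V) ≤ μ (⋃ k ∈ K ξ n, O k) :=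
        measure_mono fun x hx => ((hVmem ξ x).1 hx).2 n
      refine (hle.trans_lt (hK ξ n hξ).2).trans (lt_of_le_of_lt ?_ hn)
      exact ENNReal.inv_le_inv.2 le_self_add
    · have : Prod.mk ξ ⁻¹' V = ∅ :=
        Set.eq_empty_of_forall_notMem fun x hx => hξ ((hVmem ξ x).1 hx).1
      simp [this]
  rw [Measure.prod_apply_symm hV, lintegral_eq_zero_iff (measurable_measure_prodMk_right hV)]
    at hprod
  refine hS ?_
  rw [hν]
  refine measure_mono_null (fun x hx => ?_) (ae_iff.1 hprod)
  obtain ⟨η, hη, hxη⟩ := Set.mem_iUnion₂.1 hx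
  intro h0
  refine hS (measure_mono_null (t := (fun ξ => (ξ, x)) ⁻¹' V ∪ (Set.Iio η ∪ {η})) ?_
    (measure_union_null h0 (measure_union_null hη (hsingle η))))
  intro ξ hξ
  rcases lt_trichotomy η ξ with hlt | rfl | hlt
  · exact Or.inl ((hVmem ξ x).2 ⟨hξ, fun n => (hK ξ n hξ).1 (Set.mem_biUnion hlt hxη)⟩)
  · exact Or.inr (Or.inr rfl)
  · exact Or.inr (Or.inl hlt)

theorem stmt3 {X : Type*} [TopologicalSpace X] [SecondCountableTopology X]
    [MeasurableSpace X] [BorelSpace X] (μ : Measure X) [SigmaFinite μ] (hμ : μ ≠ 0)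
    {Γ : Type*} (A : Γ → Set X)
    (hdisj : Pairwise (Function.onFun Disjoint A))
    (hnull : ∀ γ, μ (A γ) = 0)
    (hE : μ (⋃ γ, A γ) ≠ 0) :
    ∃ Δ : Set Γ,
      (¬ ∃ B : Set X, NullMeasurableSet B μ ∧ (⋃ γ ∈ Δ, A γ) ⊆ B ∧
        B ∩ (⋃ γ ∈ Δᶜ, A γ) = ∅) ∧
      ¬ NullMeasurableSet (⋃ γ ∈ Δ, A γ) μ := by
  suffices h : ∃ Δ : Set Γ, ¬ ∃ B : Set X, NullMeasurableSet B μ ∧ (⋃ γ ∈ Δ, A γ) ⊆ B ∧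
      B ∩ (⋃ γ ∈ Δᶜ, A γ) = ∅ by
    obtain ⟨Δ, hΔ⟩ := h
    refine ⟨Δ, hΔ, fun hmeas => hΔ ⟨_, hmeas, subset_rfl, ?_⟩⟩
    rw [← Set.disjoint_iff_inter_eq_empty]
    simp only [Set.disjoint_iUnion_left, Set.disjoint_iUnion_right]
    intro i hi j hj
    exact hdisj fun hij => hi (hij ▸ hj)
  by_contra! hsep
  refine hE (absolutelyContinuous_toFinite μ
    (measure_iUnion_eq_zero_of_forall_separated μ.toFinite A
      (fun γ => toFinite_absolutelyContinuous μ (hnull γ)) fun Δ => ?_))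
  obtain ⟨B, hB, hBΔ⟩ := hsep Δ
  exact ⟨B, hB.mono_ac (toFinite_absolutelyContinuous μ), hBΔ⟩
end

section
/- Let X be a second countable Baire space, Y a metric space, and f : X → Y a function with the Baire property. Then there exists a meager set P ⊆ X such that the restriction of f to X \ P is continuous. -/
open Filter Set TopologicalSpace Cardinal

theorem IsMeagre.exists_seq_dense_open {X : Type*} [TopologicalSpace X] {s : Set X}
    (hs : IsMeagre s) :
    ∃ G : ℕ → Set X, (∀ n, IsOpen (G n)) ∧ (∀ n, Dense (G n)) ∧ ∀ x ∈ s, ∃ n, x ∉ G n := by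
  obtain ⟨S, hSo, hSd, hSc, hS⟩ := mem_residual_iff.1 (show sᶜ ∈ residual X from hs)
  obtain rfl | hne := S.eq_empty_or_nonempty
  · refine ⟨fun _ => univ, fun _ => isOpen_univ, fun _ => dense_univ, fun x hx => ?_⟩
    exact absurd hx (hS (by simp))
  · obtain ⟨G, rfl⟩ := hSc.exists_eq_range hne
    refine ⟨G, fun n => hSo _ ⟨n, rfl⟩, fun n => hSd _ ⟨n, rfl⟩, fun x hx => ?_⟩
    by_contra! h
    exact hS (by simpa using h) hx

/-- If every set agrees with an open set modulo a filter of comeagre sets in which all points are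
negligible, then some initial segment is nonmeagre. -/
theorem exists_not_isMeagre_initialSegment {J : Type*} [TopologicalSpace J]
    [SecondCountableTopology J] [LinearOrder J] (l : Filter J) [CountableInterFilter l] [l.NeBot]
    (hres : l ≤ residual J) (hopen : ∀ U : Set J, IsOpen U → U.Nonempty → ∃ᶠ x in l, x ∈ U)
    (hBP : ∀ S : Set J, ∃ U, IsOpen U ∧ ∀ᶠ x in l, (x ∈ S ↔ x ∈ U))
    (hgt : ∀ a, ∀ᶠ x in l, a < x) {T : Set J} (hT : T ∈ l) :
    ∃ γ, ¬ IsMeagre {x | x ∈ T ∧ x < γ} := by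
  by_contra! h
  choose G hGo hGd hG using fun γ => (h γ).exists_seq_dense_open
  have hB := isBasis_countableBasis J
  have : Countable (countableBasis J) := countable_countableBasis J
  have ht : ∀ γ n (s : countableBasis J), ∃ t : countableBasis J, (t : Set J) ⊆ s ∩ G γ n := by
    intro γ n s
    have hso := hB.isOpen s.2
    obtain ⟨x, hx⟩ := (hGd γ n).inter_open_nonempty s hso (nonempty_of_mem_countableBasis s.2)
    obtain ⟨t, htB, -, ht⟩ := hB.exists_subset_of_mem_open hx (hso.inter (hGo γ n))
    exact ⟨⟨t, htB⟩, ht⟩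
  choose t ht using ht
  choose O hO hOt using fun n s u => hBP {γ | t γ n s = u}
  have hN : ∀ᶠ γ in l, ∀ n s u, (t γ n s = u ↔ γ ∈ O n s u) := by
    simp only [eventually_countable_forall]
    exact hOt
  have hR : ∀ n (b : countableBasis J), Dense (⋃ (s) (u : countableBasis J)
      (_ : ((b : Set J) ∩ O n s u).Nonempty), (u : Set J)) := by
    intro n b
    refine dense_iff_inter_open.2 fun U hU ⟨x, hx⟩ => ?_
    obtain ⟨s, hsB, -, hs⟩ := hB.exists_subset_of_mem_open hx hU
    obtain ⟨γ, hγb, hγ⟩ := ((hopen b (hB.isOpen b.2)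
      (nonempty_of_mem_countableBasis b.2)).and_eventually hN).exists
    obtain ⟨y, hy⟩ := nonempty_of_mem_countableBasis (t γ n ⟨s, hsB⟩).2
    refine ⟨y, hs (ht γ n ⟨s, hsB⟩ hy).1, ?_⟩
    simp only [mem_iUnion]
    exact ⟨_, _, ⟨γ, hγb, (hγ _ _ _).1 rfl⟩, hy⟩
  have hRl : ∀ᶠ β in l, ∀ n (b : countableBasis J), β ∈ (⋃ (s) (u : countableBasis J)
      (_ : ((b : Set J) ∩ O n s u).Nonempty), (u : Set J)) := by
    simp only [eventually_countable_forall]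
    exact fun n b => hres (residual_of_dense_open
      (isOpen_iUnion fun s => isOpen_iUnion fun u => isOpen_iUnion fun _ => hB.isOpen u.2) (hR n b))
  obtain ⟨β, hβ, hβT⟩ := (hRl.and hT).exists
  have hV : ∀ n, Dense (⋃ (s) (u : countableBasis J) (_ : β ∈ (u : Set J)), O n s u) := by
    intro n
    refine dense_iff_inter_open.2 fun U hU ⟨x, hx⟩ => ?_
    obtain ⟨b, hbB, -, hb⟩ := hB.exists_subset_of_mem_open hx hU
    have := hβ n ⟨b, hbB⟩
    simp only [mem_iUnion] at this
    obtain ⟨s, u, ⟨y, hyb, hyO⟩, hu⟩ := this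
    refine ⟨y, hb hyb, ?_⟩
    simp only [mem_iUnion]
    exact ⟨s, u, hu, hyO⟩
  have hVl : ∀ᶠ γ in l, ∀ n, γ ∈ (⋃ (s) (u : countableBasis J) (_ : β ∈ (u : Set J)), O n s u) := by
    simp only [eventually_countable_forall]
    exact fun n => hres (residual_of_dense_open
      (isOpen_iUnion fun s => isOpen_iUnion fun u => isOpen_iUnion fun _ => hO n s u) (hV n))
  obtain ⟨γ, hγV, hγN, hγ⟩ := (hVl.and (hN.and (hgt β))).exists
  obtain ⟨n, hn⟩ := hG γ β ⟨hβT, hγ⟩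
  have := hγV n
  simp only [mem_iUnion] at this
  obtain ⟨s, u, hu, huO⟩ := this
  have := (hγN n s u).2 huO
  subst this
  exact hn (ht γ n s hu).2

/-- There is a family of more than `#J` self-maps of `J`, any two of which agree only on a bounded
set. -/
theorem exists_almostDisjoint_functions {J : Type*} [LinearOrder J]
    (hJ : ∀ γ (u : J → J), ∃ a, ∀ δ ≤ γ, u δ ≠ a) :
    ∃ F : Set (J → J), #J < #F ∧
      F.Pairwise fun f g => ∃ γ, ∀ α, f α = g α → α < γ := by
  obtain ⟨F, hF⟩ := zorn_subset {F : Set (J → J) |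
      F.Pairwise fun f g => ∃ γ, ∀ α, f α = g α → α < γ} (by
    intro c hc hchain
    refine ⟨⋃₀ c, (pairwise_sUnion hchain.directedOn).2 fun s hs => hc hs, fun s hs =>
      subset_sUnion_of_mem hs⟩)
  refine ⟨F, ?_, hF.prop⟩
  by_contra! hle
  obtain ⟨i⟩ := hle
  have hinv : ∃ e : J → J → J, F ⊆ range e := by
    refine ⟨Function.extend i Subtype.val fun _ => id, fun f hf => ⟨i ⟨f, hf⟩, ?_⟩⟩
    rw [i.injective.extend_apply]
  obtain ⟨e, he⟩ := hinv
  choose f hf using fun α => hJ α fun δ => e δ α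
  have hfF : f ∈ F := by
    have hins : insert f F ∈ {F : Set (J → J) |
        F.Pairwise fun f g => ∃ γ, ∀ α, f α = g α → α < γ} := by
      refine hF.prop.insert fun g hg _ => ?_
      obtain ⟨δ, rfl⟩ := he hg
      have : ∀ α, e δ α = f α → α < δ := fun α h => lt_of_not_ge fun hle => hf α δ hle h
      exact ⟨⟨δ, fun α h => this α h.symm⟩, ⟨δ, this⟩⟩
    exact hF.le_of_ge hins (subset_insert _ _) (mem_insert _ _)
  obtain ⟨δ, hδ⟩ := he hfF
  exact hf δ δ le_rfl (congrFun hδ δ)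

/-- A second countable T₀ topology on a linear order, together with a suitably complete filter
extending the residual filter, cannot have every set agreeing with an open set modulo the filter. -/
theorem false_of_forall_eventually_iff_isOpen {J : Type*} [TopologicalSpace J]
    [SecondCountableTopology J] [T0Space J] [LinearOrder J]
    (l : Filter J) [CountableInterFilter l] [l.NeBot]
    (hres : l ≤ residual J) (hopen : ∀ U : Set J, IsOpen U → U.Nonempty → ∃ᶠ x in l, x ∈ U)
    (hBP : ∀ S : Set J, ∃ U, IsOpen U ∧ ∀ᶠ x in l, (x ∈ S ↔ x ∈ U))
    (hne : ∀ a, ∀ᶠ x in l, x ≠ a)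
    (hadd : ∀ (γ : J) (p : J → J → Prop), (∀ δ < γ, ∀ᶠ x in l, p δ x) →
      ∀ᶠ x in l, ∀ δ < γ, p δ x) : False := by
  have hgt : ∀ a, ∀ᶠ x in l, a < x := by
    intro a
    filter_upwards [hadd a (fun δ x => x ≠ δ) fun δ _ => hne δ, hne a] with x hx hxa
    exact lt_of_le_of_ne (le_of_not_gt fun h => hx x h rfl) hxa.symm
  have hsup : ∀ γ (u : J → J), ∃ a, ∀ δ < γ, u δ < a := fun γ u =>
    (hadd γ (fun δ x => u δ < x) fun δ _ => hgt _).exists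
  have hinf : Infinite J := by
    obtain ⟨a, -⟩ := (hgt (Classical.choice l.nonempty_of_neBot)).exists
    have : Nonempty J := ⟨a⟩
    have : NoMaxOrder J := ⟨fun a => (hgt a).exists⟩
    exact NoMaxOrder.infinite
  obtain ⟨F, hFcard, hF⟩ := exists_almostDisjoint_functions (J := J) (by
    intro γ u
    obtain ⟨a, ha, ha'⟩ := ((hadd γ (fun δ x => x ≠ u δ) fun δ _ => hne _).and (hne (u γ))).exists
    refine ⟨a, fun δ hδ => ?_⟩
    obtain rfl | hlt := hδ.eq_or_lt
    exacts [ha'.symm, (ha δ hlt).symm])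
  have hB := isBasis_countableBasis J
  have : Countable (countableBasis J) := countable_countableBasis J
  choose O hO hOf using fun (f : J → J) (c : countableBasis J) => hBP {α | f α ∈ (c : Set J)}
  let T : (J → J) → Set J := fun f => {α | ∀ c : countableBasis J, f α ∈ (c : Set J) ↔ α ∈ O f c}
  have hT : ∀ f, T f ∈ l := fun f => eventually_countable_forall.2 (hOf f)
  choose γ hγ using fun f =>
    exists_not_isMeagre_initialSegment l hres hopen hBP hgt (hT f)
  choose γ' hγ' using fun f : J → J => hsup (γ f) f
  obtain ⟨⟨g, g'⟩, hfib⟩ := infinite_pigeonhole_card_lt (fun f : F => (γ f, γ' f))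
    (by simpa [mk_prod] using hFcard) ((aleph0_le_mk J).trans hFcard.le)
  have hfib' : #J ≤ _ := (by simp [mk_prod] : #J ≤ #(J × J)).trans hfib.le
  obtain ⟨i⟩ := hfib'
  let h : J → J → J := fun j => (i j).1.1
  have hhF : ∀ j, h j ∈ F := fun j => (i j).1.2
  have hhinj : Function.Injective h := fun j k hjk => i.injective (Subtype.ext (Subtype.ext hjk))
  have hhγ : ∀ j, γ (h j) = g ∧ γ' (h j) = g' := fun j => Prod.ext_iff.1 (i j).2
  choose P hP hPh using fun y k => hBP {j | y ∈ T (h j) ∧ h j y = k}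
  have hN : ∀ᶠ j in l, ∀ y < g, ∀ k < g', (y ∈ T (h j) ∧ h j y = k) ↔ j ∈ P y k :=
    hadd g _ fun y _ => hadd g' _ fun k _ => hPh y k
  obtain ⟨j, hj⟩ := hN.exists
  have hY : ∃ b ∈ countableBasis J, j ∈ b ∧ ¬ IsMeagre {y | y < g ∧ ∃ k < g', b ⊆ P y k} := by
    by_contra! hcon
    refine hγ (h j) ((isMeagre_biUnion ((countable_countableBasis J).mono (sep_subset _ (j ∈ ·)))
      (f := fun b => {y | y < g ∧ ∃ k < g', b ⊆ P y k}) fun b hb => hcon b hb.1 hb.2).mono ?_)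
    rintro y ⟨hyT, hy⟩
    rw [(hhγ j).1] at hy
    have hk : h j y < g' := by
      have := hγ' (h j) y (by rwa [(hhγ j).1])
      rwa [(hhγ j).2] at this
    obtain ⟨b, hb, hjb, hbP⟩ := hB.exists_subset_of_mem_open ((hj y hy _ hk).1 ⟨hyT, rfl⟩) (hP _ _)
    exact mem_biUnion (show b ∈ _ from ⟨hb, hjb⟩) ⟨hy, _, hk, hbP⟩
  obtain ⟨b, hb, hjb, hbY⟩ := hY
  obtain ⟨j', hj'b, hj', hjj'⟩ :=
    ((hopen b (hB.isOpen hb) ⟨j, hjb⟩).and_eventually (hN.and (hne j))).exists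
  obtain ⟨a, ha⟩ := hF (hhF j) (hhF j') fun he => hjj' (hhinj he).symm
  let Q : Set J := ⋂ c, {α | α ∈ O (h j) c ↔ α ∈ O (h j') c}
  have hQ : BaireMeasurableSet Q := by
    refine BaireMeasurableSet.iInter fun c => ?_
    have h1 := (hO (h j) c).baireMeasurableSet
    have h2 := (hO (h j') c).baireMeasurableSet
    convert (h1.inter h2).union (h1.compl.inter h2.compl) using 1
    ext α
    simp only [mem_ofPred_eq, mem_union, mem_inter_iff, mem_compl_iff]
    tauto
  obtain ⟨U, hU, hQU⟩ := hQ.residualEq_isOpen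
  have hQU' : ∀ᶠ x in residual J, x ∈ Q ↔ x ∈ U := hQU.mem_iff
  obtain rfl | hUne := U.eq_empty_or_nonempty
  · refine hbY (IsMeagre.mono (t := {y | y < g ∧ ∃ k < g', b ⊆ P y k}) (s := Q) ?_ ?_)
    · rintro y ⟨hy, k, hk, hbP⟩
      obtain ⟨hyT, hyk⟩ := (hj y hy k hk).2 (hbP hjb)
      obtain ⟨hyT', hyk'⟩ := (hj' y hy k hk).2 (hbP hj'b)
      refine mem_iInter.2 fun c => ?_
      change _ ↔ _
      rw [← hyT c, ← hyT' c, hyk, hyk']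
    · filter_upwards [hQU'] with x hx
      simpa using hx
  · obtain ⟨x, hxU, hxQ, hxT, hxT', hxa⟩ := ((hopen U hU hUne).and_eventually
      ((hQU'.filter_mono hres).and ((show ∀ᶠ x in l, x ∈ T (h j) from hT (h j)).and
        ((show ∀ᶠ x in l, x ∈ T (h j') from hT (h j')).and (hgt a))))).exists
    refine hxa.not_gt (ha x ?_)
    refine (hB.inseparable_iff.2 fun c hc => ?_).eq
    rw [hxT ⟨c, hc⟩, hxT' ⟨c, hc⟩]
    exact mem_iInter.1 (hxQ.2 hxU) ⟨c, hc⟩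

/-- A nonprincipal, suitably complete filter on a linear order with a countable separating family of
sets does not have a countable family of sets that is dense modulo the filter. -/
theorem false_of_countable_dense {J : Type*} [LinearOrder J]
    (l : Filter J) [CountableInterFilter l] [l.NeBot] (hne : ∀ a, ∀ᶠ x in l, x ≠ a)
    (hadd : ∀ (γ : J) (p : J → J → Prop), (∀ δ < γ, ∀ᶠ x in l, p δ x) →
      ∀ᶠ x in l, ∀ δ < γ, p δ x)
    (D : Set (Set J)) (hDc : D.Countable)
    (hD : ∀ S : Set J, (∃ᶠ x in l, x ∈ S) →
      ∃ d ∈ D, (∃ᶠ x in l, x ∈ d) ∧ ∀ᶠ x in l, x ∈ d → x ∈ S)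
    (C : Set (Set J)) (hCc : C.Countable) (J₀ : Set J) (hJ₀ : J₀ ∈ l)
    (hC : ∀ x ∈ J₀, ∀ y ∈ J₀, (∀ c ∈ C, x ∈ c ↔ y ∈ c) → x = y) : False := by
  let : TopologicalSpace J := generateFrom (C ∪ D)
  have : SecondCountableTopology J := ⟨⟨C ∪ D, hCc.union hDc, rfl⟩⟩
  have hCo : ∀ c ∈ C, IsOpen c := fun c hc => isOpen_generateFrom_of_mem (Or.inl hc)
  have hDo : ∀ d ∈ D, IsOpen d := fun d hd => isOpen_generateFrom_of_mem (Or.inr hd)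
  have hB := isBasis_countableBasis J
  let K : Set J := {x | x ∈ J₀ ∧ ∀ b ∈ countableBasis J, x ∈ b → ∃ᶠ y in l, y ∈ b}
  have hK : K ∈ l := by
    refine inter_mem hJ₀ ((eventually_countable_ball (countable_countableBasis J)).2 fun b hb => ?_)
    by_cases h : ∃ᶠ y in l, y ∈ b
    · exact Eventually.of_forall fun x _ => h
    · filter_upwards [not_frequently.1 h] with x hx hxb using absurd hxb hx
  have hKopen : ∀ V : Set J, IsOpen V → ∀ x ∈ K, x ∈ V → ∃ᶠ y in l, y ∈ V := by
    intro V hV x hx hxV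
    obtain ⟨b, hb, hxb, hbV⟩ := hB.exists_subset_of_mem_open hxV hV
    exact (hx.2 b hb hxb).mono fun y hy => hbV hy
  let l' : Filter K := comap Subtype.val l
  have hmap : map Subtype.val l' = l := map_comap_of_mem (by simpa using hK)
  have hev : ∀ p : J → Prop, (∀ᶠ x in l', p x.1) ↔ ∀ᶠ x in l, p x := fun p => by
    conv_rhs => rw [← hmap]
    exact Iff.rfl
  have hfr : ∀ p : J → Prop, (∃ᶠ x in l', p x.1) ↔ ∃ᶠ x in l, p x := fun p =>
    not_congr (hev fun x => ¬ p x)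
  have : l'.NeBot := by
    rw [← map_neBot_iff (Subtype.val : K → J), hmap]
    infer_instance
  have : T0Space K := by
    refine ⟨fun x y hxy => Subtype.ext (hC _ x.2.1 _ y.2.1 fun c hc => ?_)⟩
    exact ((subtype_inseparable_iff _ _).1 hxy).mem_open_iff (hCo c hc)
  refine false_of_forall_eventually_iff_isOpen l' ?_ ?_ ?_ ?_ ?_
  · intro W hW
    obtain ⟨S, hSo, hSd, hSc, hS⟩ := mem_residual_iff.1 hW
    refine mem_of_superset ((countable_sInter_mem hSc).2 fun V hV => ?_) hS
    obtain ⟨V', hV', rfl⟩ := isOpen_induced_iff.1 (hSo V hV)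
    refine (hev (· ∈ V')).2 ?_
    by_contra hcon
    obtain ⟨d, hdD, hd, hdV⟩ := hD V'ᶜ (not_eventually.1 hcon)
    obtain ⟨x, hxd, hxK⟩ := (hd.and_eventually hK).exists
    obtain ⟨y, hyd, hyV⟩ := (hSd _ hV).inter_open_nonempty (Subtype.val ⁻¹' d)
      ((hDo d hdD).preimage continuous_subtype_val) ⟨⟨x, hxK⟩, hxd⟩
    obtain ⟨z, hz, hz'⟩ := ((hKopen (d ∩ V') ((hDo d hdD).inter hV') y y.2
      ⟨hyd, hyV⟩).and_eventually hdV).exists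
    exact hz' hz.1 hz.2
  · rintro U hU ⟨x, hx⟩
    obtain ⟨V, hV, rfl⟩ := isOpen_induced_iff.1 hU
    exact (hfr (· ∈ V)).2 (hKopen V hV x x.2 hx)
  · intro S
    let S' : Set J := Subtype.val '' S
    let U : Set J := ⋃ d ∈ {d ∈ D | ∀ᶠ x in l, x ∈ d → x ∈ S'}, d
    have hU : IsOpen U := isOpen_biUnion fun d hd => hDo d hd.1
    refine ⟨Subtype.val ⁻¹' U, hU.preimage continuous_subtype_val, ?_⟩
    have h1 : ∀ᶠ x in l, x ∈ U → x ∈ S' := by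
      have := (eventually_countable_ball (l := l) (hDc.mono (sep_subset D
        fun d => ∀ᶠ x in l, x ∈ d → x ∈ S')) (p := fun x d _ => x ∈ d → x ∈ S')).2 fun d hd => hd.2
      filter_upwards [this] with x hx hxU
      obtain ⟨d, hd, hxd⟩ := mem_iUnion₂.1 hxU
      exact hx d hd hxd
    have h2 : ∀ᶠ x in l, x ∈ S' → x ∈ U := by
      by_contra hcon
      obtain ⟨d, hdD, hd, hdS⟩ := hD (S' \ U) ((not_eventually.1 hcon).mono fun x hx => by
        simpa using hx)
      obtain ⟨x, hxd, hx⟩ := (hd.and_eventually hdS).exists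
      exact (hx hxd).2 (mem_biUnion (show d ∈ _ from ⟨hdD, hdS.mono fun y hy hyd => (hy hyd).1⟩) hxd)
    have h3 : ∀ᶠ x in l', x.1 ∈ S' ↔ x.1 ∈ U := (hev fun x => x ∈ S' ↔ x ∈ U).2 (by
      filter_upwards [h1, h2] with x h h' using ⟨h', h⟩)
    filter_upwards [h3] with x hx
    rw [mem_preimage, ← hx]
    simp [S']
  · intro a
    exact ((hev (· ≠ a.1)).2 (hne a)).mono fun x hx h => hx (congrArg _ h)
  · intro γ p hp
    have := (hev _).2 (hadd γ
      (fun δ x => ∀ (hδ : δ ∈ K) (hx : x ∈ K), p ⟨δ, hδ⟩ ⟨x, hx⟩) fun δ hδ => by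
      by_cases hδK : δ ∈ K
      · exact (hev _).1 ((hp ⟨δ, hδK⟩ hδ).mono fun x hx _ _ => hx)
      · exact Eventually.of_forall fun x h => absurd h hδK)
    exact this.mono fun x hx δ hδ => hx δ hδ δ.2 x.2

theorem isMeagre_diff_union_diff_of_residualEq {X : Type*} [TopologicalSpace X] {s t : Set X}
    (h : s =ᶠ[residual X] t) : IsMeagre (s \ t ∪ t \ s) := by
  filter_upwards [h.mem_iff] with x hx
  simp only [mem_compl_iff, mem_union, Set.mem_sdiff]
  tauto

/-- A nonmeagre Baire measurable set is comeagre in some nonmeagre basic open set. -/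
theorem BaireMeasurableSet.exists_mem_countableBasis {X : Type*} [TopologicalSpace X]
    [SecondCountableTopology X] {s : Set X} (hs : BaireMeasurableSet s) (hsm : ¬ IsMeagre s) :
    ∃ b ∈ countableBasis X, ¬ IsMeagre b ∧ IsMeagre (b \ s) := by
  obtain ⟨U, hU, hsU⟩ := hs.residualEq_isOpen
  have hM := isMeagre_diff_union_diff_of_residualEq hsU
  by_contra! h
  refine hsm (((isMeagre_biUnion ((countable_countableBasis X).mono (sep_subset _ (· ⊆ U)))
    (f := fun b => b) fun b hb => ?_).union hM).mono ?_)
  · by_contra hbm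
    exact h b hb.1 hbm (hM.mono fun x hx => Or.inr ⟨hb.2 hx.1, hx.2⟩)
  · intro x hx
    by_cases hxU : x ∈ U
    · obtain ⟨b, hb, hxb, hbU⟩ := (isBasis_countableBasis X).exists_subset_of_mem_open hxU hU
      exact Or.inl (mem_biUnion (show b ∈ _ from ⟨hb, hbU⟩) hxb)
    · exact Or.inr (Or.inl ⟨hx, hxU⟩)

/-- In a disjoint family all of whose subunions are Baire measurable, there is a largest index set,
modulo meagre unions, whose union is meagre in a given set. -/
theorem exists_maximal_isMeagre_inter {X J : Type*} [TopologicalSpace X]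
    [SecondCountableTopology X] {E : J → Set X} (hdisj : ∀ i j x, x ∈ E i → x ∈ E j → i = j)
    (hE : ∀ A : Set J, BaireMeasurableSet (⋃ j ∈ A, E j)) (b : Set X) :
    ∃ S : Set J, IsMeagre (b ∩ ⋃ j ∈ S, E j) ∧
      ∀ A : Set J, IsMeagre (b ∩ ⋃ j ∈ A, E j) → IsMeagre (⋃ j ∈ A \ S, E j) := by
  choose U hU hEU using fun A => (hE A).residualEq_isOpen
  have hM := fun A => isMeagre_diff_union_diff_of_residualEq (hEU A)
  obtain ⟨T, hTF, hTc, hT⟩ := isOpen_biUnion_countable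
    {A : Set J | IsMeagre (b ∩ ⋃ j ∈ A, E j)} U fun A _ => hU A
  refine ⟨⋃ A ∈ T, A, ?_, fun A hA => ?_⟩
  · refine (isMeagre_biUnion hTc (f := fun A => b ∩ ⋃ j ∈ A, E j) fun A hA => hTF hA).mono ?_
    rintro x ⟨hxb, hx⟩
    simp only [mem_iUnion] at hx ⊢
    obtain ⟨j, ⟨A, hA, hj⟩, hxj⟩ := hx
    exact ⟨A, hA, hxb, by simpa using ⟨j, hj, hxj⟩⟩
  · refine ((hM A).union (isMeagre_biUnion hTc fun A _ => hM A)).mono ?_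
    intro x hx
    obtain ⟨j, ⟨hjA, hjT⟩, hxj⟩ := mem_iUnion₂.1 hx
    by_cases hxU : x ∈ U A
    · have : x ∈ ⋃ A ∈ T, U A := hT ▸ mem_biUnion hA hxU
      obtain ⟨B, hB, hxB⟩ := mem_iUnion₂.1 this
      refine Or.inr (mem_biUnion hB (Or.inr ⟨hxB, fun hxE => ?_⟩))
      obtain ⟨k, hk, hxk⟩ := mem_iUnion₂.1 hxE
      exact hjT (mem_biUnion hB (hdisj _ _ _ hxj hxk ▸ hk))
    · exact Or.inl (Or.inl ⟨mem_biUnion hjA hxj, hxU⟩)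

/-- Modulo meagre unions, the indices of a disjoint family all of whose subunions are Baire
measurable are separated by countably many sets. -/
theorem exists_countable_separating_index {X J : Type*} [TopologicalSpace X]
    [SecondCountableTopology X] {E : J → Set X} (hdisj : ∀ i j x, x ∈ E i → x ∈ E j → i = j)
    (hE : ∀ A : Set J, BaireMeasurableSet (⋃ j ∈ A, E j)) :
    ∃ (J₀ : Set J) (C : Set (Set J)), IsMeagre (⋃ j ∈ J₀ᶜ, E j) ∧ C.Countable ∧
      ∀ i ∈ J₀, ∀ j ∈ J₀, (∀ c ∈ C, i ∈ c ↔ j ∈ c) → i = j := by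
  let R : Set (SeparationQuotient X) := SeparationQuotient.mk '' ⋃ j, E j
  have hR : ∀ q : R, ∃ j, ∃ x ∈ E j, SeparationQuotient.mk x = q.1 := by
    rintro ⟨-, x, hx, rfl⟩
    obtain ⟨j, hj⟩ := mem_iUnion.1 hx
    exact ⟨j, x, hj, rfl⟩
  choose g p hp hpq using hR
  let r : range g → R := fun j => j.2.choose
  have hr : ∀ j : range g, g (r j) = j := fun j => j.2.choose_spec
  refine ⟨range g, (fun b => {j | ∃ h : j ∈ range g, p (r ⟨j, h⟩) ∈ b}) '' countableBasis X, ?_,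
    (countable_countableBasis X).image _, ?_⟩
  · obtain ⟨U, hU, hEU⟩ := (hE (range g)).residualEq_isOpen
    obtain ⟨G, hGo, hGd, hG⟩ :=
      (isMeagre_diff_union_diff_of_residualEq hEU).exists_seq_dense_open
    have hGm : IsMeagre (⋃ n, (G n)ᶜ) := isMeagre_iUnion fun n => by
      rw [IsMeagre, compl_compl]
      exact residual_of_dense_open (hGo n) (hGd n)
    refine hGm.mono fun x hx => ?_
    obtain ⟨j, hj, hxj⟩ := mem_iUnion₂.1 hx
    by_contra hxG
    simp only [mem_iUnion, mem_compl_iff, not_exists, not_not] at hxG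
    let q : R := ⟨SeparationQuotient.mk x, x, mem_iUnion.2 ⟨j, hxj⟩, rfl⟩
    have hins : Inseparable (p q) x := SeparationQuotient.mk_eq_mk.1 (hpq q)
    have hpU : p q ∈ U := by
      by_contra hpU
      obtain ⟨n, hn⟩ := hG (p q) (Or.inl ⟨mem_biUnion (mem_range_self q) (hp q), hpU⟩)
      exact hn ((hins.mem_open_iff (hGo n)).2 (hxG n))
    have hxU : x ∈ U := (hins.mem_open_iff hU).1 hpU
    have hxE : x ∉ ⋃ j ∈ range g, E j := fun h => by
      obtain ⟨k, hk, hxk⟩ := mem_iUnion₂.1 h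
      exact hj (hdisj _ _ _ hxj hxk ▸ hk)
    obtain ⟨n, hn⟩ := hG x (Or.inr ⟨hxU, hxE⟩)
    exact hn (hxG n)
  · intro i hi j hj hij
    have hins : Inseparable (p (r ⟨i, hi⟩)) (p (r ⟨j, hj⟩)) := by
      refine (isBasis_countableBasis X).inseparable_iff.2 fun b hb => ?_
      have := hij _ (mem_image_of_mem _ hb)
      simpa only [mem_ofPred_eq, hi, hj, exists_true_left] using this
    have : r ⟨i, hi⟩ = r ⟨j, hj⟩ := Subtype.ext (by
      rw [← hpq, ← hpq]
      exact SeparationQuotient.mk_eq_mk.2 hins)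
    exact (hr ⟨i, hi⟩).symm.trans ((congrArg g this).trans (hr ⟨j, hj⟩))

theorem isMeagre_iUnion_of_linearOrder {X J : Type*} [TopologicalSpace X]
    [SecondCountableTopology X] [LinearOrder J] {E : J → Set X}
    (hdisj : ∀ i j x, x ∈ E i → x ∈ E j → i = j)
    (hE : ∀ A : Set J, BaireMeasurableSet (⋃ j ∈ A, E j)) (hEm : ∀ j, IsMeagre (E j))
    (hadd : ∀ (γ : J) (A : J → Set J), (∀ δ < γ, IsMeagre (⋃ j ∈ A δ, E j)) →
      IsMeagre (⋃ j ∈ ⋃ δ < γ, A δ, E j)) : IsMeagre (⋃ j, E j) := by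
  by_contra hEn
  let l : Filter J := Filter.ofCountableUnion {A | IsMeagre (⋃ j ∈ A, E j)}
    (fun S hSc hS => by
      change IsMeagre _
      rw [sUnion_eq_biUnion]
      simp only [biUnion_iUnion]
      exact isMeagre_biUnion hSc hS)
    fun A hA B hBA => hA.mono (biUnion_subset_biUnion_left hBA)
  have hl : ∀ p : J → Prop, (∀ᶠ j in l, p j) ↔ IsMeagre (⋃ j ∈ {j | ¬ p j}, E j) := fun p =>
    Iff.rfl
  have hlf : ∀ p : J → Prop, (∃ᶠ j in l, p j) ↔ ¬ IsMeagre (⋃ j ∈ {j | p j}, E j) := fun p => by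
    rw [Filter.Frequently, hl]
    simp
  have : l.NeBot := by
    refine ⟨fun h => hEn ?_⟩
    have : ∀ᶠ j in l, False := by simp [h]
    simpa using (hl _).1 this
  choose S hS hSmax using exists_maximal_isMeagre_inter hdisj hE
  obtain ⟨J₀, C, hJ₀, hCc, hC⟩ := exists_countable_separating_index hdisj hE
  refine false_of_countable_dense l (fun a => ?_) (fun γ p hp => ?_)
    ((fun b => (S b)ᶜ) '' countableBasis X) ((countable_countableBasis X).image _) (fun A hA => ?_)
    C hCc J₀ hJ₀ hC
  · rw [hl]
    simpa using hEm a
  · rw [hl]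
    convert hadd γ (fun δ => {j | ¬ p δ j}) hp using 3
    simp
  · obtain ⟨b, hb, hbm, hbA⟩ := (hE A).exists_mem_countableBasis ((hlf _).1 hA)
    refine ⟨_, mem_image_of_mem _ hb, ?_, ?_⟩
    · refine (hlf _).2 fun h => hbm (((hbA.union h).union (hS b)).mono fun x hx => ?_)
      by_cases hxA : x ∈ ⋃ j ∈ A, E j
      · obtain ⟨j, -, hj⟩ := mem_iUnion₂.1 hxA
        by_cases hjS : j ∈ S b
        · exact Or.inr ⟨hx, mem_biUnion hjS hj⟩
        · exact Or.inl (Or.inr (mem_biUnion (show j ∈ {j | j ∈ (S b)ᶜ} from hjS) hj))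
      · exact Or.inl (Or.inl ⟨hx, hxA⟩)
    · rw [hl]
      have : IsMeagre (b ∩ ⋃ j ∈ Aᶜ, E j) := hbA.mono fun x hx => by
        refine ⟨hx.1, fun hxA => ?_⟩
        obtain ⟨j, hj, hxj⟩ := mem_iUnion₂.1 hx.2
        obtain ⟨k, hk, hxk⟩ := mem_iUnion₂.1 hxA
        exact hj (hdisj _ _ _ hxj hxk ▸ hk)
      refine (hSmax b _ this).mono (biUnion_subset_biUnion_left fun j hj => ?_)
      simpa [and_comm] using hj

/-- The union of a disjoint family of meagre sets all of whose subunions are Baire measurable is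
meagre. -/
theorem isMeagre_iUnion_of_forall_baireMeasurableSet {X : Type*} {J : Type*} [TopologicalSpace X]
    [SecondCountableTopology X] {E : J → Set X}
    (hdisj : ∀ i j x, x ∈ E i → x ∈ E j → i = j)
    (hE : ∀ A : Set J, BaireMeasurableSet (⋃ j ∈ A, E j)) (hEm : ∀ j, IsMeagre (E j)) :
    IsMeagre (⋃ j, E j) := by
  induction hc : #J using WellFoundedLT.induction generalizing J with | _ c ih =>
  obtain ⟨e⟩ : Nonempty (J ≃ c.ord.ToType) := Cardinal.eq.1 (by rw [mk_ord_toType, hc])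
  have hsub : ∀ A : Set c.ord.ToType,
      (⋃ j ∈ A, E (e.symm j)) = ⋃ j ∈ e ⁻¹' A, E j := fun A => by
    rw [← e.image_symm_eq_preimage, biUnion_image]
  rw [← e.symm.surjective.iUnion_comp]
  refine isMeagre_iUnion_of_linearOrder (fun i j x hi hj => e.symm.injective (hdisj _ _ x hi hj))
    (fun A => hsub A ▸ hE _) (fun j => hEm _) fun γ A hA => ?_
  let A' : c.ord.ToType → Set c.ord.ToType := fun δ => A δ \ ⋃ ε < δ, A ε
  have hA' : ∀ i j x, x ∈ A' i → x ∈ A' j → i = j := by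
    intro i j x hi hj
    by_contra hne
    obtain h | h := lt_or_gt_of_ne hne
    · exact hj.2 (mem_biUnion h hi.1)
    · exact hi.2 (mem_biUnion h hj.1)
  have := ih #(Iio γ) (by simpa using mk_Iio_lt γ (by simp))
    (E := fun δ : Iio γ => ⋃ j ∈ A' δ, E (e.symm j))
    (fun i j x hi hj => ?_) (fun B => ?_) (fun δ => ?_) rfl
  · refine this.mono fun x hx => ?_
    obtain ⟨j, hj, hxj⟩ := mem_iUnion₂.1 hx
    have hne : {δ | δ < γ ∧ j ∈ A δ}.Nonempty := by simpa [Set.Nonempty] using hj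
    obtain ⟨δ, hδ, hmin⟩ := WellFounded.has_min (wellFounded_lt (α := c.ord.ToType)) _ hne
    refine mem_iUnion.2 ⟨⟨δ, hδ.1⟩, mem_biUnion (show j ∈ A' δ from ⟨hδ.2, fun h => ?_⟩) hxj⟩
    obtain ⟨ε, hε, hj⟩ := mem_iUnion₂.1 h
    exact hmin ε ⟨hε.trans hδ.1, hj⟩ hε
  · obtain ⟨a, ha, hxa⟩ := mem_iUnion₂.1 hi
    obtain ⟨b, hb, hxb⟩ := mem_iUnion₂.1 hj
    have := e.symm.injective (hdisj _ _ _ hxa hxb)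
    subst this
    exact Subtype.ext (hA' _ _ _ ha hb)
  · have := hE (e ⁻¹' ⋃ δ ∈ B, A' δ)
    rw [← hsub] at this
    simpa only [biUnion_iUnion] using this
  · exact (hA δ δ.2).mono (biUnion_subset_biUnion_left sdiff_subset)

/-- In a disjoint family all of whose subunions are Baire measurable, all but countably many members
have meagre union. -/
theorem exists_countable_isMeagre_biUnion_compl {X J : Type*} [TopologicalSpace X]
    [SecondCountableTopology X] {E : J → Set X}
    (hdisj : ∀ i j x, x ∈ E i → x ∈ E j → i = j)
    (hE : ∀ A : Set J, BaireMeasurableSet (⋃ j ∈ A, E j)) :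
    ∃ K : Set J, K.Countable ∧ IsMeagre (⋃ j ∈ Kᶜ, E j) := by
  refine ⟨{j | ¬ IsMeagre (E j)}, ?_, ?_⟩
  · have h : ∀ j : {j | ¬ IsMeagre (E j)}, ∃ b : countableBasis X, ¬ IsMeagre (b : Set X) ∧
        IsMeagre ((b : Set X) \ E j) := fun j => by
      obtain ⟨b, hb, h⟩ := BaireMeasurableSet.exists_mem_countableBasis
        (by simpa using hE {j.1}) j.2
      exact ⟨⟨b, hb⟩, h⟩
    choose b hb hbE using h
    have : Countable (countableBasis X) := countable_countableBasis X
    refine Set.countable_coe_iff.1 (Function.Injective.countable (f := b) fun i j hij => ?_)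
    by_contra hne
    refine hb i (((hbE i).union (hbE j)).mono fun x hx => ?_)
    by_cases hxi : x ∈ E i
    · exact Or.inr ⟨hij ▸ hx, fun hxj => hne (Subtype.ext (hdisj _ _ _ hxi hxj))⟩
    · exact Or.inl ⟨hx, hxi⟩
  · rw [biUnion_eq_iUnion]
    refine isMeagre_iUnion_of_forall_baireMeasurableSet
      (fun i j x hi hj => Subtype.ext (hdisj _ _ x hi hj)) (fun A => ?_) fun j => not_not.1 j.2
    have := hE (Subtype.val '' A)
    rwa [biUnion_image] at this

/-- For every `ε > 0`, a metric space has a σ-disjoint open cover by subsets of `ε`-balls. -/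
theorem Metric.exists_sigmaDisjoint_open_cover {Y : Type*} [MetricSpace Y] {ε : ℝ} (hε : 0 < ε) :
    ∃ V : ℕ → Y → Set Y, (∀ n y, IsOpen (V n y)) ∧ (∀ n y z p, p ∈ V n y → p ∈ V n z → y = z) ∧
      (∀ n y, V n y ⊆ ball y ε) ∧ ∀ p, ∃ n y, p ∈ V n y := by
  obtain ⟨_, _⟩ := exists_wellFoundedLT Y
  let δ : ℕ → ℝ := fun n => 1 / ((n : ℝ) + 1)
  have hδ : ∀ n, 0 < δ n := fun n => Nat.one_div_pos_of_nat
  let D : ℕ → Y → Set Y := fun n y =>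
    {p | p ∈ ball y ε ∧ (∀ z < y, p ∉ ball z ε) ∧ ball p (δ n) ⊆ ball y ε}
  refine ⟨fun n y => ⋃ p ∈ D n y, ball p (δ n / 2), fun n y => isOpen_biUnion fun _ _ => isOpen_ball,
    ?_, fun n y => iUnion₂_subset fun p hp =>
      (ball_subset_ball (half_le_self (hδ n).le)).trans hp.2.2, fun p => ?_⟩
  · have key : ∀ n y z x, y < z → x ∈ ⋃ p ∈ D n y, ball p (δ n / 2) →
        x ∉ ⋃ p ∈ D n z, ball p (δ n / 2) := by
      intro n y z x hyz hy hz
      obtain ⟨p, hp, hxp⟩ := mem_iUnion₂.1 hy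
      obtain ⟨q, hq, hxq⟩ := mem_iUnion₂.1 hz
      refine hq.2.1 y hyz (hp.2.2 ?_)
      rw [mem_ball] at hxp hxq ⊢
      linarith [dist_triangle_left q p x]
    intro n y z x hy hz
    obtain h | h | h := lt_trichotomy y z
    · exact absurd hz (key n y z x h hy)
    · exact h
    · exact absurd hy (key n z y x h hz)
  · obtain ⟨y, hy, hmin⟩ := WellFounded.has_min (wellFounded_lt (α := Y)) {y | p ∈ ball y ε}
      ⟨p, mem_ball_self hε⟩
    obtain ⟨r, hr, hball⟩ := Metric.isOpen_iff.1 isOpen_ball p hy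
    obtain ⟨n, hn⟩ := exists_nat_one_div_lt hr
    exact ⟨n, y, mem_biUnion (show p ∈ D n y from ⟨hy, fun z hz h => hmin z h hz,
      (ball_subset_ball hn.le).trans hball⟩) (mem_ball_self (half_pos (hδ n)))⟩

/-- A function into a metric space with Baire measurable preimages of open sets takes values near a
countable set, off a meagre set. -/
theorem exists_countable_isMeagre_setOf_forall_dist {X Y : Type*} [TopologicalSpace X]
    [SecondCountableTopology X] [MetricSpace Y] {f : X → Y}
    (hf : ∀ V, IsOpen V → BaireMeasurableSet (f ⁻¹' V)) {ε : ℝ} (hε : 0 < ε) :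
    ∃ K : Set Y, K.Countable ∧ IsMeagre {x | ∀ y ∈ K, ε ≤ dist (f x) y} := by
  obtain ⟨V, hVo, hVd, hVb, hV⟩ := Metric.exists_sigmaDisjoint_open_cover (Y := Y) hε
  choose K hK hKm using fun n => exists_countable_isMeagre_biUnion_compl
    (E := fun y => f ⁻¹' V n y) (fun y z x => hVd n y z (f x)) fun A => by
      rw [← preimage_iUnion₂]
      exact hf _ (isOpen_biUnion fun y _ => hVo n y)
  refine ⟨⋃ n, K n, countable_iUnion hK, (isMeagre_iUnion hKm).mono fun x hx => ?_⟩
  obtain ⟨n, y, hy⟩ := hV (f x)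
  refine mem_iUnion.2 ⟨n, mem_biUnion (fun hyK => ?_) hy⟩
  exact (hx y (mem_iUnion.2 ⟨n, hyK⟩)).not_gt (hVb n y hy)

theorem HasBaireProp.baireMeasurableSet {X : Type*} [TopologicalSpace X] {S : Set X}
    (h : HasBaireProp S) : BaireMeasurableSet S := by
  obtain ⟨U, hU, hSU⟩ := h
  refine hU.baireMeasurableSet.congr ?_
  filter_upwards [show (symmDiff S U)ᶜ ∈ residual X from hSU] with x hx
  simp only [mem_compl_iff, Set.mem_symmDiff] at hx
  exact propext (show x ∈ U ↔ x ∈ S by tauto)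

theorem stmt14 {X Y : Type*} [TopologicalSpace X] [SecondCountableTopology X]
    [BaireSpace X] [MetricSpace Y] (f : X → Y)
    (hf : ∀ V : Set Y, IsOpen V → HasBaireProp (f ⁻¹' V)) :
    ∃ P : Set X, IsMeagre P ∧ Continuous (Set.restrict Pᶜ f) := by
  have hδ : ∀ n : ℕ, 0 < 1 / ((n : ℝ) + 1) := fun n => Nat.one_div_pos_of_nat
  choose K hK hKm using fun n => exists_countable_isMeagre_setOf_forall_dist
    (fun V hV => (hf V hV).baireMeasurableSet) (hδ n)
  choose U hU hUm using fun n y => hf (Metric.ball y (1 / ((n : ℝ) + 1))) Metric.isOpen_ball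
  refine ⟨_, (isMeagre_iUnion hKm).union
    (isMeagre_iUnion fun n => isMeagre_biUnion (hK n) fun y _ => hUm n y), ?_⟩
  rw [continuous_iff_continuousAt]
  rintro ⟨x, hx⟩
  rw [ContinuousAt, Metric.tendsto_nhds]
  intro ε hε
  have hUP : ∀ x ∉ (⋃ n, {x | ∀ y ∈ K n, 1 / ((n : ℝ) + 1) ≤ dist (f x) y}) ∪
      ⋃ n, ⋃ y ∈ K n, symmDiff (f ⁻¹' Metric.ball y (1 / ((n : ℝ) + 1))) (U n y),
      ∀ n, ∀ y ∈ K n, f x ∈ Metric.ball y (1 / ((n : ℝ) + 1)) ↔ x ∈ U n y := by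
    intro x hx n y hy
    have : x ∉ symmDiff (f ⁻¹' Metric.ball y (1 / ((n : ℝ) + 1))) (U n y) := fun h =>
      hx (Or.inr (mem_iUnion.2 ⟨n, mem_biUnion hy h⟩))
    rw [Set.mem_symmDiff, mem_preimage] at this
    tauto
  obtain ⟨n, hn⟩ := exists_nat_one_div_lt (half_pos hε)
  obtain ⟨y, hy, hxy⟩ : ∃ y ∈ K n, dist (f x) y < 1 / ((n : ℝ) + 1) := by
    by_contra! h
    exact hx (Or.inl (mem_iUnion.2 ⟨n, h⟩))
  filter_upwards [((hU n y).preimage continuous_subtype_val).mem_nhds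
    ((hUP x hx n y hy).1 hxy)] with z hz
  have h := (hUP z z.2 n y hy).2 hz
  rw [Metric.mem_ball] at h
  change dist (f z) (f x) < ε
  linarith [dist_triangle_right (f z) (f x) y]
end
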